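/- arXiv:1603.06386 — 3 statements merged into one kernel-verified Lean document; each statement's English description precedes it below -/
import Mathlib

section
/- Let s ≥ 1 and N ≥ 1 be integers. For integers m_i, n_i with 1 ≤ m_i ≤ N, 1 ≤ n_i ≤ N and reals x_i^−, x_i^+ ∈ [0,1), let A := ∏_{i=1}^s [(m_i − x_i^− − 1)/N, (m_i + n_i + x_i^+ − 1)/N], and assume A ⊆ [0,1]^s. Then ∑ λ_s(A ∩ J̄_j) λ_s(A ∩ J̄_{j′}) = N^{−2s} ∏_{i=1}^s ( n_i(n_i + x_i^− + x_i^+ − 1) + (n_i + x_i^−) x_i^+ + (n_i + x_i^+) x_i^− ), where the sum is over all pairs of multi-indices j, j′ ∈ {1,…,N}^s with j_i ≠ j′_i for every i = 1, …, s, and J̄_j := ∏_{i=1}^s [(j_i−1)/N, j_i/N). -/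
open MeasureTheory

/-- The sum over pairs of functions that differ at every coordinate of a product of coordinatewise
weights factors as a product of off-diagonal sums. -/
lemma sum_filter_forall_ne_prod_mul_prod {ι κ R : Type*} [Fintype ι] [DecidableEq ι] [Fintype κ]
    [DecidableEq κ] [CommSemiring R] (w : ι → κ → R)
    [DecidablePred fun p : (ι → κ) × (ι → κ) => ∀ i, p.1 i ≠ p.2 i] :
    ∑ p ∈ Finset.univ.filter (fun p : (ι → κ) × (ι → κ) => ∀ i, p.1 i ≠ p.2 i),
        (∏ i, w i (p.1 i)) * ∏ i, w i (p.2 i)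
      = ∏ i, ∑ q ∈ Finset.univ.filter (fun q : κ × κ => q.1 ≠ q.2), w i q.1 * w i q.2 := by
  rw [Finset.prod_univ_sum]
  refine Finset.sum_equiv (Equiv.arrowProdEquivProdArrow ι (fun _ => κ) (fun _ => κ)).symm ?_ ?_
  · intro p
    simp [Fintype.mem_piFinset, Equiv.arrowProdEquivProdArrow]
  · intro p _
    simp [Finset.prod_mul_distrib, Equiv.arrowProdEquivProdArrow]

/-- An off-diagonal sum of products is the square of the sum minus the sum of squares. -/
lemma sum_filter_ne_mul {κ R : Type*} [Fintype κ] [DecidableEq κ] [CommRing R] (f : κ → R) :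
    ∑ q ∈ Finset.univ.filter (fun q : κ × κ => q.1 ≠ q.2), f q.1 * f q.2
      = (∑ k, f k) ^ 2 - ∑ k, f k ^ 2 := by
  rw [eq_sub_iff_add_eq, sq, Fintype.sum_mul_sum, ← Fintype.sum_prod_type',
    ← Finset.sum_filter_add_sum_filter_not Finset.univ (fun q : κ × κ => q.1 ≠ q.2)]
  congr 1
  rw [Finset.sum_filter, Fintype.sum_prod_type]
  simp [sq]

/-- The profile on `ℕ` equal to `1` on the block `[m - 1, m + n - 1)`, to `a` just before it and
to `b` just after it. -/
def blockProfile (m n : ℕ) (a b : ℝ) (k : ℕ) : ℝ :=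
  (if m ≤ k + 1 ∧ k + 1 < m + n then 1 else 0) + (if k + 2 = m then a else 0)
    + (if k + 1 = m + n then b else 0)

lemma blockProfile_sq (m n : ℕ) (a b : ℝ) (k : ℕ) :
    blockProfile m n a b k ^ 2 = blockProfile m n (a ^ 2) (b ^ 2) k := by
  unfold blockProfile
  split_ifs <;> first | omega | ring

lemma sum_blockProfile {N m n : ℕ} {a b : ℝ} (hm : 1 ≤ m) (hmN : m ≤ N) (hmn : m + n ≤ N + 1)
    (ha : m = 1 → a = 0) (hb : m + n = N + 1 → b = 0) :
    ∑ k : Fin N, blockProfile m n a b k = n + a + b := by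
  rw [Fin.sum_univ_eq_sum_range (fun k => blockProfile m n a b k)]
  unfold blockProfile
  rw [Finset.sum_add_distrib, Finset.sum_add_distrib]
  congr 1
  · congr 1
    · rw [← Finset.sum_filter]
      have h : (Finset.range N).filter (fun k => m ≤ k + 1 ∧ k + 1 < m + n)
          = Finset.Ico (m - 1) (m - 1 + n) := by
        ext k
        simp only [Finset.mem_filter, Finset.mem_range, Finset.mem_Ico]
        omega
      simp [h]
    · by_cases h : m = 1
      · simp [ha h]
      · rw [Finset.sum_eq_single (m - 2)]
        · rw [if_pos (by omega)]
        · intro k _ hk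
          rw [if_neg (by omega)]
        · intro hk
          exact absurd (Finset.mem_range.2 (by omega)) hk
  · by_cases h : m + n = N + 1
    · simp [hb h]
    · rw [Finset.sum_eq_single (m + n - 1)]
      · rw [if_pos (by omega)]
      · intro k _ hk
        rw [if_neg (by omega)]
      · intro hk
        exact absurd (Finset.mem_range.2 (by omega)) hk

/-- The length of the intersection of a closed interval with a half-open one. -/
lemma Real.volume_real_Icc_inter_Ico (a b c d : ℝ) :
    volume.real (Set.Icc a b ∩ Set.Ico c d) = max (min b d - max a c) 0 := by
  have h : (Set.Icc a b ∩ Set.Ico c d : Set ℝ) =ᵐ[volume]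
      (Set.Icc a b ∩ Set.Icc c d : Set ℝ) :=
    ae_eq_set_inter (ae_eq_refl _) Ico_ae_eq_Icc
  rw [measureReal_congr h, Set.Icc_inter_Icc, Real.volume_real_Icc]

lemma volume_real_Icc_inter_cell {N : ℕ} (hN : 1 ≤ N) {m n : ℕ} (hn : 1 ≤ n) {a b : ℝ}
    (ha : a ∈ Set.Ico (0 : ℝ) 1) (hb : b ∈ Set.Ico (0 : ℝ) 1) (k : ℕ) :
    volume.real (Set.Icc (((m : ℝ) - a - 1) / N) (((m : ℝ) + n + b - 1) / N)
        ∩ Set.Ico ((k : ℝ) / N) ((k + 1 : ℝ) / N))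
      = blockProfile m n a b k / N := by
  have hN' : (0 : ℝ) < N := by exact_mod_cast hN
  obtain ⟨ha0, ha1⟩ := ha
  obtain ⟨hb0, hb1⟩ := hb
  have hn' : (1 : ℝ) ≤ n := by exact_mod_cast hn
  rw [Real.volume_real_Icc_inter_Ico, min_div_div_right hN'.le, max_div_div_right hN'.le,
    ← sub_div, ← zero_div (N : ℝ), max_div_div_right hN'.le]
  congr 1
  unfold blockProfile
  rcases lt_or_ge (k + 2) m with h | h
  · have h' : (k : ℝ) + 3 ≤ m := by exact_mod_cast h
    rw [if_neg (by omega), if_neg (by omega), if_neg (by omega), max_eq_right]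
    · simp
    · linarith [min_le_right ((m : ℝ) + n + b - 1) (k + 1), le_max_left ((m : ℝ) - a - 1) k]
  rcases eq_or_lt_of_le h with h | h
  · have h' : (m : ℝ) = k + 2 := by exact_mod_cast h
    rw [if_neg (by omega), if_pos h.symm, if_neg (by omega), min_eq_right (by linarith),
      max_eq_left (a := (m : ℝ) - a - 1) (by linarith), max_eq_left (by linarith)]
    linarith
  have h' : (m : ℝ) ≤ k + 1 := by exact_mod_cast (by omega : m ≤ k + 1)
  rw [max_eq_right (a := (m : ℝ) - a - 1) (by linarith)]
  rcases lt_trichotomy (k + 1) (m + n) with g | g | g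
  · have g' : (k : ℝ) + 2 ≤ m + n := by exact_mod_cast g
    rw [if_pos (by omega), if_neg (by omega), if_neg (by omega), min_eq_right (by linarith),
      max_eq_left (by linarith)]
    linarith
  · have g' : (k : ℝ) + 1 = m + n := by exact_mod_cast g
    rw [if_neg (by omega), if_neg (by omega), if_pos g, min_eq_left (by linarith),
      max_eq_left (by linarith)]
    linarith
  · have g' : (m : ℝ) + n + 1 ≤ k + 1 := by exact_mod_cast g
    rw [if_neg (by omega), if_neg (by omega), if_neg (by omega), min_eq_left (by linarith),
      max_eq_right (by linarith)]
    simp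

/-- **Closed form for the off-diagonal sum of cell-measure products.**
Let `s ≥ 1`, `N ≥ 1`, and for each coordinate `i` let `1 ≤ m_i ≤ N`,
`1 ≤ n_i ≤ N` and `x_i⁻, x_i⁺ ∈ [0,1)`.  Let
`A = ∏_i [(m_i − x_i⁻ − 1)/N, (m_i + n_i + x_i⁺ − 1)/N] ⊆ [0,1]^s`.
Then the sum of `λ_s(A ∩ J̄_j) λ_s(A ∩ J̄_{j'})` over all pairs of
multi-indices `j, j' ∈ {1,…,N}^s` with `j_i ≠ j'_i` for every `i` equals
`N^{-2s} ∏_i (n_i(n_i + x_i⁻ + x_i⁺ − 1) + (n_i + x_i⁻)x_i⁺ + (n_i + x_i⁺)x_i⁻)`,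
where `J̄_j = ∏_i [(j_i−1)/N, j_i/N)` are the cells of the uniform grid of mesh
`1/N` on `[0,1)^s`. -/
theorem stmt_4 (s N : ℕ) (hs : 1 ≤ s) (hN : 1 ≤ N)
    (m n : Fin s → ℕ) (hm : ∀ i, 1 ≤ m i ∧ m i ≤ N) (hn : ∀ i, 1 ≤ n i ∧ n i ≤ N)
    (xm xp : Fin s → ℝ) (hxm : ∀ i, xm i ∈ Set.Ico (0 : ℝ) 1)
    (hxp : ∀ i, xp i ∈ Set.Ico (0 : ℝ) 1)
    (A : Set (Fin s → ℝ))
    (hA : A = Set.univ.pi fun i =>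
      Set.Icc (((m i : ℝ) - xm i - 1) / N) (((m i : ℝ) + (n i : ℝ) + xp i - 1) / N))
    (hAsub : A ⊆ Set.univ.pi fun _ => Set.Icc (0 : ℝ) 1) :
    ∑ p ∈ Finset.univ.filter
        (fun p : (Fin s → Fin N) × (Fin s → Fin N) => ∀ i, p.1 i ≠ p.2 i),
        (volume (A ∩ Set.univ.pi fun i =>
            Set.Ico ((p.1 i : ℝ) / N) (((p.1 i : ℕ) + 1 : ℝ) / N))).toReal
          * (volume (A ∩ Set.univ.pi fun i =>
              Set.Ico ((p.2 i : ℝ) / N) (((p.2 i : ℕ) + 1 : ℝ) / N))).toReal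
      = ((N : ℝ) ^ (2 * s))⁻¹
          * ∏ i : Fin s,
            ((n i : ℝ) * ((n i : ℝ) + xm i + xp i - 1)
              + ((n i : ℝ) + xm i) * xp i + ((n i : ℝ) + xp i) * xm i) := by
  have hN' : (0 : ℝ) < N := by exact_mod_cast hN
  have hle : ∀ i, ((m i : ℝ) - xm i - 1) / N ≤ ((m i : ℝ) + (n i : ℝ) + xp i - 1) / N := by
    intro i
    have := (hxm i).1
    have := (hxp i).1
    gcongr
    linarith [(n i).cast_nonneg (α := ℝ)]
  have hlo : ∀ i, xm i + 1 ≤ m i := by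
    intro i
    have h : (fun i => ((m i : ℝ) - xm i - 1) / N) ∈ A := by
      rw [hA]
      exact fun i _ => ⟨le_rfl, hle i⟩
    have := (hAsub h i trivial).1
    rw [le_div_iff₀ hN'] at this
    linarith
  have hhi : ∀ i, (m i : ℝ) + n i + xp i ≤ N + 1 := by
    intro i
    have h : (fun i => ((m i : ℝ) + (n i : ℝ) + xp i - 1) / N) ∈ A := by
      rw [hA]
      exact fun i _ => ⟨hle i, le_rfl⟩
    have := (hAsub h i trivial).2
    rw [div_le_iff₀ hN'] at this
    linarith
  have hvol : ∀ j : Fin s → Fin N, (volume (A ∩ Set.univ.pi fun i =>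
      Set.Ico ((j i : ℝ) / N) (((j i : ℕ) + 1 : ℝ) / N))).toReal
        = ∏ i, blockProfile (m i) (n i) (xm i) (xp i) (j i) / N := by
    intro j
    rw [hA, ← Set.pi_inter_distrib, volume_pi_pi, ENNReal.toReal_prod]
    exact Finset.prod_congr rfl fun i _ =>
      volume_real_Icc_inter_cell hN (hn i).1 (hxm i) (hxp i) (j i)
  have hpow : ((N : ℝ) ^ (2 * s))⁻¹ = ∏ _i : Fin s, ((N : ℝ) ^ 2)⁻¹ := by simp [pow_mul]
  simp only [hvol]
  rw [sum_filter_forall_ne_prod_mul_prod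
    (fun i (k : Fin N) => blockProfile (m i) (n i) (xm i) (xp i) k / N), hpow,
    ← Finset.prod_mul_distrib]
  refine Finset.prod_congr rfl fun i _ => ?_
  have hm1 : m i = 1 → xm i = 0 := by
    intro h
    have h₁ := hlo i
    rw [h, Nat.cast_one] at h₁
    linarith [(hxm i).1]
  have hmn : m i + n i ≤ N + 1 := by
    have : (m i : ℝ) + n i ≤ N + 1 := by linarith [hhi i, (hxp i).1]
    exact_mod_cast this
  have hmN : m i + n i = N + 1 → xp i = 0 := by
    intro h
    have h₁ : (m i : ℝ) + n i = N + 1 := by exact_mod_cast h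
    linarith [(hxp i).1, hhi i]
  rw [sum_filter_ne_mul (fun k : Fin N => blockProfile (m i) (n i) (xm i) (xp i) k / N)]
  simp only [div_pow, blockProfile_sq, ← Finset.sum_div]
  rw [sum_blockProfile (hm i).1 (hm i).2 hmn hm1 hmN,
    sum_blockProfile (hm i).1 (hm i).2 hmn (fun h => by simp [hm1 h]) (fun h => by simp [hmN h])]
  field_simp
  ring
end

section
/- Let N ≥ 3, m ≥ 1, n ≥ 1 be integers and let x, y ∈ [0,1) be reals such that m − x − 1 ≥ 0 and m + n + y − 1 ≤ N (i.e., the interval [(m−x−1)/N, (m+n+y−1)/N] is contained in [0,1]). Then N( n(n + x + y − 1) + (n + x) y + (n + y) x ) ≤ (N−1)(n + x + y)^2. -/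
/-- In one coordinate, each factor of the first product in the covariance formula
for the LHS estimator of the measure of a subinterval of `[0,1)^s` is dominated by
the corresponding factor of the second product. -/
theorem stmt_6 (N m n : ℕ) (hN : 3 ≤ N) (hm : 1 ≤ m) (hn : 1 ≤ n)
    (x y : ℝ) (hx : x ∈ Set.Ico (0 : ℝ) 1) (hy : y ∈ Set.Ico (0 : ℝ) 1)
    (hlow : 0 ≤ (m : ℝ) - x - 1) (hhigh : (m : ℝ) + n + y - 1 ≤ N) :
    (N : ℝ) * ((n : ℝ) * ((n : ℝ) + x + y - 1) + ((n : ℝ) + x) * y + ((n : ℝ) + y) * x)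
      ≤ ((N : ℝ) - 1) * ((n : ℝ) + x + y) ^ 2 := by
  obtain ⟨hx0, -⟩ := hx
  obtain ⟨hy0, -⟩ := hy
  have hn' : (1 : ℝ) ≤ n := by exact_mod_cast hn
  have hm' : (1 : ℝ) ≤ m := by exact_mod_cast hm
  have hm2 : 0 < x → (2 : ℝ) ≤ m := fun h => by
    have : (1 : ℝ) < m := by linarith
    exact_mod_cast this
  have hmn : 0 < y → (m : ℝ) + n ≤ N := fun h => by
    have : (m : ℝ) + n < N + 1 := by linarith
    exact_mod_cast Nat.lt_succ_iff.mp (by exact_mod_cast this)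
  -- It suffices to bound the square of the length by Cauchy-Schwarz.
  suffices h : ((n : ℝ) + x + y) ^ 2 ≤ N * (n + x ^ 2 + y ^ 2) by nlinarith
  have hpos : (0 : ℝ) ≤ n + x ^ 2 + y ^ 2 := by positivity
  rcases hx0.eq_or_lt with rfl | hx0 <;> rcases hy0.eq_or_lt with rfl | hy0
  · have : (n : ℝ) ≤ N := by linarith
    nlinarith
  · have : (n : ℝ) + 1 ≤ N := by linarith [hmn hy0]
    refine le_trans ?_ (mul_le_mul_of_nonneg_right this hpos)
    nlinarith [mul_nonneg (by positivity : (0 : ℝ) ≤ n) (sq_nonneg (y - 1))]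
  · have : (n : ℝ) + 1 ≤ N := by linarith [hm2 hx0]
    refine le_trans ?_ (mul_le_mul_of_nonneg_right this hpos)
    nlinarith [mul_nonneg (by positivity : (0 : ℝ) ≤ n) (sq_nonneg (x - 1))]
  · have : (n : ℝ) + 2 ≤ N := by linarith [hm2 hx0, hmn hy0]
    refine le_trans ?_ (mul_le_mul_of_nonneg_right this hpos)
    nlinarith [mul_nonneg (by positivity : (0 : ℝ) ≤ n) (sq_nonneg (x - 1)),
      mul_nonneg (by positivity : (0 : ℝ) ≤ n) (sq_nonneg (y - 1)), sq_nonneg (x - y)]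
end

section
/- Let s ≥ 1 and n ≥ 1 be integers and N := n^s. Let σ^1, …, σ^s be bijections from {1, …, n}^{s−1} onto {1, …, n^{s−1}}, let U_ℓ^i ∈ [0,1), and let W*_ℓ be defined by (W*_ℓ)_i := (ℓ_i − 1)/n + (σ^i(ℓ̂_i) − 1 + U_ℓ^i)/N. Then for each coordinate i ∈ {1, …, s} and each k ∈ {1, …, N}, there is exactly one multi-index ℓ ∈ {1,…,n}^s such that (W*_ℓ)_i ∈ I_k := [(k−1)/N, k/N); that is, each slab [0,1)^{i−1} × I_k × [0,1)^{s−i} contains exactly one point of the Sudoku sample. -/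
/-- For a natural number `a` and `u ∈ [0,1)`, the point `(a + u) / N` lies in the `k`-th cell of the
uniform partition of mesh `1 / N` exactly when `a = k`. -/
lemma add_div_mem_Ico_div_iff {N : ℕ} (hN : 0 < N) (a k : ℕ) {u : ℝ}
    (hu : u ∈ Set.Ico (0 : ℝ) 1) :
    ((a : ℝ) + u) / N ∈ Set.Ico ((k : ℝ) / N) (((k : ℝ) + 1) / N) ↔ a = k := by
  have hN' : (0 : ℝ) < N := by exact_mod_cast hN
  obtain ⟨hu0, hu1⟩ := hu
  rw [Set.mem_Ico, div_le_div_iff_of_pos_right hN', div_lt_div_iff_of_pos_right hN']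
  constructor
  · rintro ⟨h1, h2⟩
    have h3 : k < a + 1 := by exact_mod_cast (by linarith : (k : ℝ) < a + 1)
    have h4 : a < k + 1 := by exact_mod_cast (by linarith : (a : ℝ) < k + 1)
    omega
  · rintro rfl
    exact ⟨by linarith, by linarith⟩

/-- **The Latin hypercube property of the Sudoku sample.**  Let `s ≥ 1`,
`n ≥ 1`, `N = n^s`, let `σ^1, …, σ^s` be bijections from `{1,…,n}^{s−1}` onto
`{1,…,n^{s−1}}`, let `U_ℓ^i ∈ [0,1)`, and let the Sudoku sample points be
`(W*_ℓ)_i = (ℓ_i − 1)/n + (σ^i(ℓ̂_i) − 1 + U_ℓ^i)/N`.  Then for each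
coordinate `i` and each `k ∈ {1,…,N}` there is exactly one multi-index
`ℓ ∈ {1,…,n}^s` with `(W*_ℓ)_i ∈ I_k = [(k−1)/N, k/N)`; i.e. each slab
`[0,1)^{i−1} × I_k × [0,1)^{s−i}` contains exactly one point of the sample. -/
theorem stmt_11 (s n : ℕ) (hs : 1 ≤ s) (hn : 1 ≤ n) (N : ℕ) (hN : N = n ^ s)
    (σ : ∀ i : Fin s, ({j : Fin s // j ≠ i} → Fin n) ≃ Fin (n ^ (s - 1)))
    (U : (Fin s → Fin n) → Fin s → ℝ)
    (hU : ∀ ℓ i, U ℓ i ∈ Set.Ico (0 : ℝ) 1)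
    (W : (Fin s → Fin n) → Fin s → ℝ)
    (hW : ∀ ℓ i, W ℓ i
      = (ℓ i : ℝ) / n + (((σ i fun j => ℓ j.1) : ℕ) + U ℓ i) / N) :
    ∀ (i : Fin s) (k : Fin N),
      ∃! ℓ : Fin s → Fin n, W ℓ i ∈ Set.Ico ((k : ℝ) / N) (((k : ℕ) + 1 : ℝ) / N) := by
  intro i k
  have hNM : N = n * n ^ (s - 1) := by rw [hN, mul_pow_sub_one (by omega)]
  have hNpos : 0 < N := by rw [hN]; positivity
  let e : (Fin s → Fin n) ≃ Fin (n * n ^ (s - 1)) :=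
    ((Equiv.funSplitAt i (Fin n)).trans ((Equiv.refl _).prodCongr (σ i))).trans finProdFinEquiv
  have he : ∀ ℓ, ((e ℓ : Fin _) : ℕ) = (σ i fun j => ℓ j.1) + n ^ (s - 1) * ℓ i := fun ℓ => rfl
  have hmem : ∀ ℓ, W ℓ i ∈ Set.Ico ((k : ℝ) / N) (((k : ℕ) + 1 : ℝ) / N) ↔
      e ℓ = Fin.cast hNM k := by
    intro ℓ
    have hn0 : (n : ℝ) ≠ 0 := by positivity
    have hW' : W ℓ i = (((e ℓ : Fin _) : ℕ) + U ℓ i) / N := by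
      rw [hW, he, hNM]
      push_cast
      field_simp
      ring
    rw [hW', add_div_mem_Ico_div_iff hNpos _ _ (hU ℓ i), Fin.ext_iff, Fin.val_cast]
  simp only [hmem]
  exact e.bijective.existsUnique _
end
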